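/- arXiv:1504.04190 — 4 statements merged into one kernel-verified Lean document; each statement's English description precedes it below -/
import Mathlib

section
/- Consider the complete rooted binary tree of depth n, with vertex set of size N_n = 2^{n+1} − 1, where each vertex independently carries a gate that is AND or OR with probability 1/2 each; each leaf receives one 0 in-signal and one 1 in-signal (so a leaf outputs 1 iff its gate is OR), and each internal vertex outputs the AND resp. OR of the outputs of its two children according to its gate. Call a vertex v pivotal if changing its gate changes the output f at the root. Then: (a) for a fixed vertex v at level k with 0 ≤ k ≤ n−1, P(f = 1 and v is pivotal) = 2^{−(k+2)}; (b) for a fixed leaf v (level n), P(f = 1 and v is pivotal) = 2^{−(n+1)}; and (c) if a vertex V is chosen uniformly at random among the N_n vertices and its gate is rerandomized (replaced by an independent uniform gate), the probability that the output changes from 1 to 0 equals (n+2)/(8N_n). -/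
open MeasureTheory

/-- A vertex of the complete rooted binary tree of depth `n`: a level `k ∈ {0,…,n}`
(the root is level 0) together with an index among the `2^k` vertices at that level. -/
abbrev Vtx (n : ℕ) : Type := (k : Fin (n+1)) × Fin (2^(k.1))

/-- The output of the AND/OR tree of depth `d`: the gate configuration `ω` assigns to
each vertex `true` (an OR-gate) or `false` (an AND-gate); each leaf receives one 0 and
one 1 in-signal (so a leaf outputs 1 iff its gate is OR), and each internal vertex
combines the outputs of its two children with its gate. -/
def evalT : (d : ℕ) → (Vtx d → Bool) → Bool
  | 0, ω => ω ⟨⟨0, Nat.one_pos⟩, ⟨0, by norm_num⟩⟩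
  | d+1, ω =>
    let L := evalT d (fun s => ω ⟨⟨s.1.1 + 1, by have := s.1.isLt; omega⟩, ⟨s.2.1, by
        show s.2.1 < 2^(s.1.1 + 1)
        have h := s.2.isLt
        have h2 : (2:ℕ)^(s.1.1 + 1) = 2 * 2^(s.1.1) := by rw [pow_succ]; ring
        omega⟩⟩)
    let R := evalT d (fun s => ω ⟨⟨s.1.1 + 1, by have := s.1.isLt; omega⟩,
      ⟨2^(s.1.1) + s.2.1, by
        show 2^(s.1.1) + s.2.1 < 2^(s.1.1 + 1)
        have h := s.2.isLt
        have h2 : (2:ℕ)^(s.1.1 + 1) = 2 * 2^(s.1.1) := by rw [pow_succ]; ring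
        omega⟩⟩)
    if ω ⟨⟨0, by omega⟩, ⟨0, by norm_num⟩⟩ then L || R else L && R

/-- The Bernoulli(p) measure on `Bool` (probability `p` of `true`). -/
noncomputable def bern (p : ℝ) : Measure Bool :=
  ENNReal.ofReal p • Measure.dirac true + ENNReal.ofReal (1 - p) • Measure.dirac false

/-- The uniform measure on gate configurations: i.i.d. fair gates. -/
noncomputable def gatesμ (n : ℕ) : Measure (Vtx n → Bool) :=
  Measure.pi fun _ => bern (1/2)

open Function

/-- The root of the tree of depth `d`. -/
def Vtx.root (d : ℕ) : Vtx d := ⟨⟨0, by omega⟩, ⟨0, by norm_num⟩⟩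

/-- The copy of a vertex in the left subtree below the root. -/
def Vtx.left {d : ℕ} (s : Vtx d) : Vtx (d + 1) :=
  ⟨⟨s.1.1 + 1, by have := s.1.isLt; omega⟩, ⟨s.2.1, by
    have h := s.2.isLt
    have h2 : (2 : ℕ) ^ (s.1.1 + 1) = 2 * 2 ^ s.1.1 := by rw [pow_succ]; ring
    show s.2.1 < 2 ^ (s.1.1 + 1)
    omega⟩⟩

/-- The copy of a vertex in the right subtree below the root. -/
def Vtx.right {d : ℕ} (s : Vtx d) : Vtx (d + 1) :=
  ⟨⟨s.1.1 + 1, by have := s.1.isLt; omega⟩, ⟨2 ^ s.1.1 + s.2.1, by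
    have h := s.2.isLt
    have h2 : (2 : ℕ) ^ (s.1.1 + 1) = 2 * 2 ^ s.1.1 := by rw [pow_succ]; ring
    show 2 ^ s.1.1 + s.2.1 < 2 ^ (s.1.1 + 1)
    omega⟩⟩

theorem Vtx.ext_val {d : ℕ} {s t : Vtx d} (h₁ : s.1.1 = t.1.1) (h₂ : s.2.1 = t.2.1) :
    s = t := by
  obtain ⟨⟨k, hk⟩, i, hi⟩ := s
  obtain ⟨⟨l, hl⟩, j, hj⟩ := t
  dsimp only at h₁ h₂
  subst h₁ h₂
  rfl

theorem Vtx.left_injective {d : ℕ} : Injective (Vtx.left (d := d)) := by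
  intro s t h
  have h₁ := congrArg (fun v => v.1.1) h
  have h₂ := congrArg (fun v => v.2.1) h
  simp only [Vtx.left] at h₁ h₂
  exact Vtx.ext_val (by omega) h₂

theorem Vtx.right_injective {d : ℕ} : Injective (Vtx.right (d := d)) := by
  intro s t h
  have h₁ := congrArg (fun v => v.1.1) h
  have h₂ := congrArg (fun v => v.2.1) h
  simp only [Vtx.right] at h₁ h₂
  have h₃ : s.1.1 = t.1.1 := by omega
  have h₄ : 2 ^ s.1.1 = 2 ^ t.1.1 := congrArg (2 ^ ·) h₃
  exact Vtx.ext_val h₃ (by omega)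

theorem Vtx.left_ne_root {d : ℕ} (s : Vtx d) : s.left ≠ Vtx.root (d + 1) := by
  intro h
  have h₁ := congrArg (fun v => v.1.1) h
  simp [Vtx.left, Vtx.root] at h₁

theorem Vtx.right_ne_root {d : ℕ} (s : Vtx d) : s.right ≠ Vtx.root (d + 1) := by
  intro h
  have h₁ := congrArg (fun v => v.1.1) h
  simp [Vtx.right, Vtx.root] at h₁

theorem Vtx.left_ne_right {d : ℕ} (s t : Vtx d) : s.left ≠ t.right := by
  intro h
  have h₁ := congrArg (fun v => v.1.1) h
  have h₂ := congrArg (fun v => v.2.1) h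
  simp only [Vtx.left, Vtx.right] at h₁ h₂
  have h₃ : s.1.1 = t.1.1 := by omega
  have h₄ := s.2.isLt
  rw [h₂, h₃] at h₄
  omega

theorem Vtx.eq_root_or_left_or_right {d : ℕ} (v : Vtx (d + 1)) :
    v = Vtx.root (d + 1) ∨ (∃ s : Vtx d, v = s.left) ∨ ∃ s : Vtx d, v = s.right := by
  obtain ⟨⟨k, hk⟩, i, hi⟩ := v
  dsimp only at hi
  cases k with
  | zero =>
    left
    exact Vtx.ext_val rfl (by simp only [Vtx.root]; simpa using hi)
  | succ k =>
    right
    have h2 : (2 : ℕ) ^ (k + 1) = 2 * 2 ^ k := by rw [pow_succ]; ring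
    by_cases h : i < 2 ^ k
    · exact Or.inl ⟨⟨⟨k, by omega⟩, ⟨i, h⟩⟩, rfl⟩
    · exact Or.inr ⟨⟨⟨k, by omega⟩, ⟨i - 2 ^ k, by dsimp only; omega⟩⟩,
        Vtx.ext_val rfl (by simp only [Vtx.right]; omega)⟩

/-- Every vertex of a tree of positive depth is the root or lies in one of the two
subtrees below it. -/
noncomputable def Vtx.splitEquiv (d : ℕ) : Unit ⊕ (Vtx d ⊕ Vtx d) ≃ Vtx (d + 1) :=
  Equiv.ofBijective
    (Sum.elim (fun _ => Vtx.root (d + 1)) (Sum.elim Vtx.left Vtx.right)) <| by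
    constructor
    · rintro (_ | s | s) (_ | t | t) h
      · rfl
      · exact absurd h.symm t.left_ne_root
      · exact absurd h.symm t.right_ne_root
      · exact absurd h s.left_ne_root
      · rw [Vtx.left_injective h]
      · exact absurd h (s.left_ne_right t)
      · exact absurd h s.right_ne_root
      · exact absurd h.symm (t.left_ne_right s)
      · rw [Vtx.right_injective h]
    · intro v
      obtain rfl | ⟨s, rfl⟩ | ⟨s, rfl⟩ := v.eq_root_or_left_or_right
      · exact ⟨Sum.inl (), rfl⟩
      · exact ⟨Sum.inr (Sum.inl s), rfl⟩
      · exact ⟨Sum.inr (Sum.inr s), rfl⟩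

/-- A gate configuration consists of the gate of the root and of the configurations of
the two subtrees. -/
noncomputable def configEquiv (d : ℕ) :
    (Vtx (d + 1) → Bool) ≃ Bool × (Vtx d → Bool) × (Vtx d → Bool) :=
  ((Vtx.splitEquiv d).symm.arrowCongr (Equiv.refl Bool)).trans <|
    (Equiv.sumArrowEquivProdArrow _ _ _).trans <|
      (Equiv.funUnique Unit Bool).prodCongr (Equiv.sumArrowEquivProdArrow _ _ _)

theorem configEquiv_apply {d : ℕ} (ω : Vtx (d + 1) → Bool) :
    configEquiv d ω = (ω (Vtx.root (d + 1)), ω ∘ Vtx.left, ω ∘ Vtx.right) :=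
  rfl

theorem evalT_succ (d : ℕ) (ω : Vtx (d + 1) → Bool) :
    evalT (d + 1) ω = if ω (Vtx.root (d + 1)) then
      evalT d (ω ∘ Vtx.left) || evalT d (ω ∘ Vtx.right)
      else evalT d (ω ∘ Vtx.left) && evalT d (ω ∘ Vtx.right) :=
  rfl

theorem evalT_not (d : ℕ) (ω : Vtx d → Bool) :
    evalT d (fun v => !ω v) = !evalT d ω := by
  induction d with
  | zero => rfl
  | succ d ih =>
    have hl := ih (ω ∘ Vtx.left)
    have hr := ih (ω ∘ Vtx.right)
    rw [evalT_succ, evalT_succ]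
    change (if !ω (Vtx.root (d + 1)) then
      evalT d (fun v => !(ω ∘ Vtx.left) v) || evalT d (fun v => !(ω ∘ Vtx.right) v)
      else evalT d (fun v => !(ω ∘ Vtx.left) v) && evalT d (fun v => !(ω ∘ Vtx.right) v)) = _
    rw [hl, hr]
    cases ω (Vtx.root (d + 1)) <;> simp

/-- The configurations with output 1 for which `v` is pivotal. -/
def pivotalOne (n : ℕ) (v : Vtx n) : Finset (Vtx n → Bool) :=
  {ω | evalT n ω = true ∧ evalT n (update ω v (!ω v)) = false}

theorem mem_pivotalOne {n : ℕ} {v : Vtx n} {ω : Vtx n → Bool} :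
    ω ∈ pivotalOne n v ↔ evalT n ω = true ∧ evalT n (update ω v (!ω v)) = false := by
  simp [pivotalOne]

theorem two_mul_card_filter_of_involutive {α : Type*} [Fintype α] (g : α → Bool)
    (c : α → α) (hc : Involutive c) (hg : ∀ x, g (c x) = !g x) :
    2 * (Finset.univ.filter fun x => g x = true).card = Fintype.card α := by
  have h : (Finset.univ.filter fun x => g x = true).card =
      (Finset.univ.filter fun x => ¬ g x = true).card :=
    Finset.card_nbij' c c (by intro x; simp [hg]) (by intro x; simp [hg])
      (fun x _ => hc x) (fun x _ => hc x)
  have := Finset.card_filter_add_card_filter_not (s := (Finset.univ : Finset α))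
    (fun x => g x = true)
  rw [Finset.card_univ] at this
  omega

theorem card_config_succ (d : ℕ) : Fintype.card (Vtx (d + 1) → Bool) =
    2 * (Fintype.card (Vtx d → Bool) * Fintype.card (Vtx d → Bool)) := by
  rw [Fintype.card_congr (configEquiv d)]
  simp only [Fintype.card_prod, Fintype.card_bool]

theorem update_root_comp_left {d : ℕ} (ω : Vtx (d + 1) → Bool) (b : Bool) :
    update ω (Vtx.root (d + 1)) b ∘ Vtx.left = ω ∘ Vtx.left :=
  update_comp_eq_of_forall_ne _ _ fun s => s.left_ne_root

theorem update_root_comp_right {d : ℕ} (ω : Vtx (d + 1) → Bool) (b : Bool) :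
    update ω (Vtx.root (d + 1)) b ∘ Vtx.right = ω ∘ Vtx.right :=
  update_comp_eq_of_forall_ne _ _ fun s => s.right_ne_root

theorem mem_pivotalOne_root {d : ℕ} {ω : Vtx (d + 1) → Bool} :
    ω ∈ pivotalOne (d + 1) (Vtx.root (d + 1)) ↔ ω (Vtx.root (d + 1)) = true ∧
      (evalT d (ω ∘ Vtx.left) ^^ evalT d (ω ∘ Vtx.right)) = true := by
  rw [mem_pivotalOne, evalT_succ, evalT_succ, update_root_comp_left, update_root_comp_right,
    update_self]
  cases ω (Vtx.root (d + 1)) <;> cases evalT d (ω ∘ Vtx.left) <;>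
    cases evalT d (ω ∘ Vtx.right) <;> simp

theorem mem_pivotalOne_left {d : ℕ} {s : Vtx d} {ω : Vtx (d + 1) → Bool} :
    ω ∈ pivotalOne (d + 1) s.left ↔
      ω (Vtx.root (d + 1)) = !evalT d (ω ∘ Vtx.right) ∧ ω ∘ Vtx.left ∈ pivotalOne d s := by
  rw [mem_pivotalOne, mem_pivotalOne, evalT_succ, evalT_succ,
    update_comp_eq_of_injective _ Vtx.left_injective,
    update_comp_eq_of_forall_ne _ _ fun t => (s.left_ne_right t).symm,
    update_of_ne s.left_ne_root.symm, comp_apply]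
  cases ω (Vtx.root (d + 1)) <;> cases evalT d (ω ∘ Vtx.left) <;>
    cases evalT d (ω ∘ Vtx.right) <;> simp

theorem mem_pivotalOne_right {d : ℕ} {s : Vtx d} {ω : Vtx (d + 1) → Bool} :
    ω ∈ pivotalOne (d + 1) s.right ↔
      ω (Vtx.root (d + 1)) = !evalT d (ω ∘ Vtx.left) ∧ ω ∘ Vtx.right ∈ pivotalOne d s := by
  rw [mem_pivotalOne, mem_pivotalOne, evalT_succ, evalT_succ,
    update_comp_eq_of_injective _ Vtx.right_injective,
    update_comp_eq_of_forall_ne _ _ fun t => t.left_ne_right s,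
    update_of_ne s.right_ne_root.symm, comp_apply]
  cases ω (Vtx.root (d + 1)) <;> cases evalT d (ω ∘ Vtx.left) <;>
    cases evalT d (ω ∘ Vtx.right) <;> simp

theorem four_mul_card_pivotalOne_root (d : ℕ) :
    4 * (pivotalOne (d + 1) (Vtx.root (d + 1))).card =
      Fintype.card (Vtx (d + 1) → Bool) := by
  have h : (pivotalOne (d + 1) (Vtx.root (d + 1))).card =
      (Finset.univ.filter fun p : (Vtx d → Bool) × (Vtx d → Bool) =>
        (evalT d p.1 ^^ evalT d p.2) = true).card := by
    refine Finset.card_nbij' (fun ω => (configEquiv d ω).2)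
      (fun p => (configEquiv d).symm (true, p)) ?_ ?_ ?_ ?_
    · intro ω hω
      simpa [configEquiv_apply] using (mem_pivotalOne_root.1 hω).2
    · intro p hp
      have := configEquiv_apply ((configEquiv d).symm (true, p))
      simp only [Equiv.apply_symm_apply, Prod.ext_iff] at this
      simp only [Finset.mem_coe, mem_pivotalOne_root, ← this.1, ← this.2.1, ← this.2.2]
      simpa using hp
    · intro ω hω
      have := (mem_pivotalOne_root.1 hω).1
      rw [Equiv.symm_apply_eq, configEquiv_apply, this]
      rfl
    · intro p _
      simp
  have h2 := two_mul_card_filter_of_involutive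
    (fun p : (Vtx d → Bool) × (Vtx d → Bool) => evalT d p.1 ^^ evalT d p.2)
    (fun p => (fun v => !p.1 v, p.2)) (fun p => by simp)
    (fun p => by simp [evalT_not])
  rw [Fintype.card_prod] at h2
  rw [h, card_config_succ]
  omega

theorem card_pivotalOne_left {d : ℕ} (s : Vtx d) :
    (pivotalOne (d + 1) s.left).card =
      (pivotalOne d s).card * Fintype.card (Vtx d → Bool) := by
  rw [← Finset.card_univ, ← Finset.card_product]
  refine Finset.card_nbij' (fun ω => (ω ∘ Vtx.left, ω ∘ Vtx.right))
    (fun p => (configEquiv d).symm (!evalT d p.2, p)) ?_ ?_ ?_ ?_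
  · intro ω hω
    simpa using (mem_pivotalOne_left.1 hω).2
  · intro p hp
    have := configEquiv_apply ((configEquiv d).symm (!evalT d p.2, p))
    simp only [Equiv.apply_symm_apply, Prod.ext_iff] at this
    simp only [Finset.mem_coe, mem_pivotalOne_left, ← this.1, ← this.2.1, ← this.2.2]
    simpa using hp
  · intro ω hω
    have := (mem_pivotalOne_left.1 hω).1
    rw [Equiv.symm_apply_eq, configEquiv_apply, this]
  · intro p _
    exact (congrArg Prod.snd (configEquiv_apply _)).symm.trans (by simp)

theorem card_pivotalOne_right {d : ℕ} (s : Vtx d) :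
    (pivotalOne (d + 1) s.right).card =
      (pivotalOne d s).card * Fintype.card (Vtx d → Bool) := by
  rw [mul_comm, ← Finset.card_univ, ← Finset.card_product]
  refine Finset.card_nbij' (fun ω => (ω ∘ Vtx.left, ω ∘ Vtx.right))
    (fun p => (configEquiv d).symm (!evalT d p.1, p)) ?_ ?_ ?_ ?_
  · intro ω hω
    simpa using (mem_pivotalOne_right.1 hω).2
  · intro p hp
    have := configEquiv_apply ((configEquiv d).symm (!evalT d p.1, p))
    simp only [Equiv.apply_symm_apply, Prod.ext_iff] at this
    simp only [Finset.mem_coe, mem_pivotalOne_right, ← this.1, ← this.2.1, ← this.2.2]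
    simpa using hp
  · intro ω hω
    have := (mem_pivotalOne_right.1 hω).1
    rw [Equiv.symm_apply_eq, configEquiv_apply, this]
  · intro p _
    exact (congrArg Prod.snd (configEquiv_apply _)).symm.trans (by simp)

theorem two_pow_mul_card_pivotalOne (n : ℕ) (v : Vtx n) :
    2 ^ (if v.1.1 < n then v.1.1 + 2 else n + 1) * (pivotalOne n v).card =
      Fintype.card (Vtx n → Bool) := by
  induction n with
  | zero =>
    revert v
    decide
  | succ d ih =>
    obtain rfl | ⟨s, rfl⟩ | ⟨s, rfl⟩ := v.eq_root_or_left_or_right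
    · simpa [Vtx.root] using four_mul_card_pivotalOne_root d
    · have he : (if s.left.1.1 < d + 1 then s.left.1.1 + 2 else d + 1 + 1) =
          (if s.1.1 < d then s.1.1 + 2 else d + 1) + 1 := by
        by_cases h : s.1.1 < d <;> simp [Vtx.left, h]
      rw [he, card_pivotalOne_left, card_config_succ]
      nth_rewrite 2 [← ih s]
      ring
    · have he : (if s.right.1.1 < d + 1 then s.right.1.1 + 2 else d + 1 + 1) =
          (if s.1.1 < d then s.1.1 + 2 else d + 1) + 1 := by
        by_cases h : s.1.1 < d <;> simp [Vtx.right, h]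
      rw [he, card_pivotalOne_right, card_config_succ]
      nth_rewrite 2 [← ih s]
      ring

theorem bern_half_singleton (b : Bool) : bern (1 / 2) {b} = 2⁻¹ := by
  have h : ENNReal.ofReal (1 / 2) = 2⁻¹ := by
    rw [one_div, ENNReal.ofReal_inv_of_pos two_pos, ENNReal.ofReal_ofNat]
  have h' : ENNReal.ofReal (1 - 1 / 2) = 2⁻¹ := by rw [← h]; norm_num
  cases b <;> simp only [bern, h, h'] <;> simp

instance isProbabilityMeasure_bern_half : IsProbabilityMeasure (bern (1 / 2)) := by
  constructor
  rw [← Finset.coe_univ, ← sum_measure_singleton]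
  simp only [bern_half_singleton, Fintype.sum_bool, ENNReal.inv_two_add_inv_two]

instance isProbabilityMeasure_gatesμ (n : ℕ) : IsProbabilityMeasure (gatesμ n) := by
  unfold gatesμ; infer_instance

theorem gatesμ_singleton (n : ℕ) (ω : Vtx n → Bool) :
    gatesμ n {ω} = (Fintype.card (Vtx n → Bool) : ENNReal)⁻¹ := by
  rw [gatesμ, Measure.pi_singleton]
  simp only [bern_half_singleton, Finset.prod_const, Finset.card_univ, Fintype.card_fun,
    Fintype.card_bool]
  push_cast
  rw [ENNReal.inv_pow]

theorem gatesμ_finset_toReal {n : ℕ} (S : Finset (Vtx n → Bool)) :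
    (gatesμ n S).toReal = S.card / Fintype.card (Vtx n → Bool) := by
  rw [← sum_measure_singleton]
  simp only [gatesμ_singleton, Finset.sum_const, nsmul_eq_mul, ENNReal.toReal_mul,
    ENNReal.toReal_inv, ENNReal.toReal_natCast, div_eq_mul_inv]

theorem gatesμ_pivotalOne_toReal {n : ℕ} (v : Vtx n) :
    (gatesμ n (pivotalOne n v)).toReal =
      1 / 2 ^ (if v.1.1 < n then v.1.1 + 2 else n + 1) := by
  have h : ((2 ^ (if v.1.1 < n then v.1.1 + 2 else n + 1) * (pivotalOne n v).card : ℕ) : ℝ) =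
      (Fintype.card (Vtx n → Bool) : ℝ) := by
    rw [two_pow_mul_card_pivotalOne n v]
  have h0 : (Fintype.card (Vtx n → Bool) : ℝ) ≠ 0 := by
    exact_mod_cast Fintype.card_ne_zero
  rw [gatesμ_finset_toReal, div_eq_div_iff h0 (by positivity)]
  push_cast at h
  linarith

theorem setOf_pivotal_eq {n : ℕ} (v : Vtx n) :
    {ω | evalT n ω = true ∧ evalT n (update ω v (!ω v)) ≠ true} = (pivotalOne n v : Set _) := by
  ext ω
  simp [mem_pivotalOne]

/-- Rerandomizing the gate of `v` changes the output from 1 to 0 precisely when `v` is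
pivotal with output 1 and the new gate differs from the old one. -/
theorem rerandomize_toReal {n : ℕ} (v : Vtx n) :
    (((gatesμ n).prod (bern (1 / 2)))
      {σ | evalT n σ.1 = true ∧ evalT n (update σ.1 v σ.2) = false}).toReal =
      (gatesμ n (pivotalOne n v)).toReal / 2 := by
  rw [Measure.prod_apply (Set.toFinite _).measurableSet]
  have h : ∀ ω : Vtx n → Bool, bern (1 / 2) (Prod.mk ω ⁻¹'
      {σ | evalT n σ.1 = true ∧ evalT n (update σ.1 v σ.2) = false}) =
      (pivotalOne n v : Set (Vtx n → Bool)).indicator (fun _ => 2⁻¹) ω := by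
    intro ω
    by_cases hω : ω ∈ pivotalOne n v
    · rw [Set.indicator_of_mem (by exact hω), ← bern_half_singleton (!ω v)]
      congr 1
      rw [mem_pivotalOne] at hω
      ext b
      obtain rfl | rfl : b = ω v ∨ b = !ω v := by cases b <;> cases ω v <;> simp
      · simp [hω.1]
      · simp [hω.1, hω.2]
    · rw [Set.indicator_of_notMem (by exact hω)]
      convert measure_empty (μ := bern (1 / 2))
      rw [mem_pivotalOne] at hω
      ext b
      obtain rfl | rfl : b = ω v ∨ b = !ω v := by cases b <;> cases ω v <;> simp
      · simp
      · simpa using hω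
  simp only [h]
  rw [lintegral_indicator_const (Set.toFinite _).measurableSet, ENNReal.toReal_mul]
  simp
  ring

theorem sum_gatesμ_pivotalOne_toReal (n : ℕ) :
    ∑ v : Vtx n, (gatesμ n (pivotalOne n v)).toReal = ((n : ℝ) + 2) / 4 := by
  simp only [gatesμ_pivotalOne_toReal]
  rw [Fintype.sum_sigma]
  simp only [Finset.sum_const, Finset.card_univ, Fintype.card_fin, nsmul_eq_mul]
  rw [Fin.sum_univ_castSucc]
  have h : ∀ k : Fin n, ((2 ^ (k.castSucc : Fin (n + 1)).1 : ℕ) : ℝ) *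
      (1 / 2 ^ (if (k.castSucc : Fin (n + 1)).1 < n then (k.castSucc : Fin (n + 1)).1 + 2
        else n + 1)) = 1 / 4 := by
    intro k
    rw [if_pos (by simp)]
    push_cast
    rw [pow_add]
    field_simp
    norm_num
  rw [Finset.sum_congr rfl fun k _ => h k]
  simp only [Finset.sum_const, Finset.card_univ, Fintype.card_fin, nsmul_eq_mul, Fin.val_last,
    lt_irrefl, if_false]
  push_cast
  rw [pow_succ]
  field_simp
  ring

/-- (a) for a fixed vertex at level k ≤ n−1,
P(f = 1 and v is pivotal) = 2^{−(k+2)}; (b) for a fixed leaf (level n),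
P(f = 1 and v is pivotal) = 2^{−(n+1)}; (c) if a uniformly random vertex has its gate
rerandomized, the probability that the output changes from 1 to 0 is (n+2)/(8N_n),
where N_n = 2^{n+1} − 1 is the number of vertices. -/
theorem stmt_16 (n : ℕ) :
    (∀ (k : ℕ) (hk : k < n) (v : Fin (2^k)),
      ((gatesμ n) {ω | evalT n ω = true ∧
        evalT n (Function.update ω ⟨⟨k, by omega⟩, v⟩
          (!(ω ⟨⟨k, by omega⟩, v⟩))) ≠ true}).toReal = 1 / 2^(k+2)) ∧
    (∀ v : Fin (2^n),
      ((gatesμ n) {ω | evalT n ω = true ∧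
        evalT n (Function.update ω ⟨⟨n, by omega⟩, v⟩
          (!(ω ⟨⟨n, by omega⟩, v⟩))) ≠ true}).toReal = 1 / 2^(n+1)) ∧
    (((2:ℝ)^(n+1) - 1)⁻¹ *
      ∑ v : Vtx n,
        (((gatesμ n).prod (bern (1/2)))
          {σ | evalT n σ.1 = true ∧ evalT n (Function.update σ.1 v σ.2) = false}).toReal
      = ((n:ℝ) + 2) / (8 * ((2:ℝ)^(n+1) - 1))) := by
  refine ⟨fun k hk v => ?_, fun v => ?_, ?_⟩
  · rw [setOf_pivotal_eq, gatesμ_pivotalOne_toReal, if_pos hk]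
  · rw [setOf_pivotal_eq, gatesμ_pivotalOne_toReal, if_neg (lt_irrefl n)]
  · simp only [rerandomize_toReal]
    rw [← Finset.sum_div, sum_gatesμ_pivotalOne_toReal, div_div, mul_comm, ← div_eq_mul_inv,
      div_div]
    norm_num
end

section
/- Let τ ∈ (0, 1/2) and define (y_n) by y_0 = τ and y_{n+1} = y_n + τ/2 − (1/2)y_n² − τ y_n + τ y_n². Then the sequence (y_n) is strictly increasing, and y_n > √τ/12 for every integer n ≥ 1/(2√τ). -/
/-- The interval below the positive fixed point of the recursion is invariant. -/
lemma recursion_invariant {τ y z : ℝ} (hτ0 : 0 < τ) (hτ : τ < 1/2)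
    (hz : z = y + τ/2 - (1/2) * y^2 - τ * y + τ * y^2)
    (hy0 : 0 < y) (hy : y < 1/2) (hyz : y < z) :
    0 < z ∧ z < 1/2 ∧ z < z + τ/2 - (1/2) * z^2 - τ * z + τ * z^2 := by
  have hz' : z < 1/2 := by
    have h₁ : (1/2 - τ) * (1/2 + y) ≤ (1/2 - τ) * 1 :=
      mul_le_mul_of_nonneg_left (by linarith) (by linarith)
    have h₂ : 0 < (1/2 - y) * (1 - τ - (1/2 - τ) * (1/2 + y)) :=
      mul_pos (by linarith) (by linarith)
    nlinarith
  refine ⟨hy0.trans hyz, hz', ?_⟩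
  have h₁ : (1/2 - τ) * (y + z) ≤ (1/2 - τ) * 1 :=
    mul_le_mul_of_nonneg_left (by linarith) (by linarith)
  have h₂ : 0 < (z - y) * (1 - τ - (1/2 - τ) * (y + z)) :=
    mul_pos (by linarith) (by linarith)
  nlinarith

/-- While `y ≤ √τ / 12`, one step of the recursion increases `y` by at least `τ / 4`. -/
lemma quarter_le_increment {s y : ℝ} (hs0 : 0 < s) (hs : s ^ 2 < 1/2) (hy0 : 0 < y)
    (hy : y ≤ s / 12) :
    s^2 / 4 ≤ s^2/2 - (1/2) * y^2 - s^2 * y + s^2 * y^2 := by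
  have hs1 : s < 1 := by nlinarith
  have h₁ : y^2 ≤ (s/12)^2 := by gcongr
  have h₂ : s^2 * y ≤ s^2 * (1/12) := by gcongr; linarith
  have h₃ : 0 ≤ s^2 * y^2 := by positivity
  nlinarith [sq_nonneg s]

/-- Let τ ∈ (0, 1/2) and y₀ = τ,
y_{n+1} = y_n + τ/2 − (1/2)y_n² − τy_n + τy_n². Then (y_n) is strictly increasing
and y_n > √τ/12 for every integer n ≥ 1/(2√τ). -/
theorem stmt_17 (τ : ℝ) (hτ0 : 0 < τ) (hτ : τ < 1/2)
    (y : ℕ → ℝ) (h0 : y 0 = τ)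
    (hrec : ∀ n, y (n+1) = y n + τ/2 - (1/2) * (y n)^2 - τ * y n + τ * (y n)^2) :
    StrictMono y ∧
    (∀ n : ℕ, 1/(2 * Real.sqrt τ) ≤ (n : ℝ) → Real.sqrt τ / 12 < y n) := by
  have key : ∀ n, 0 < y n ∧ y n < 1/2 ∧ y n < y (n+1) := by
    intro n
    induction n with
    | zero =>
      have h : 0 < τ * ((1 - τ) * (1 - 2 * τ)) :=
        mul_pos hτ0 (mul_pos (by linarith) (by linarith))
      rw [hrec, h0]
      exact ⟨hτ0, hτ, by nlinarith⟩
    | succ k ih =>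
      rw [hrec (k+1)]
      exact recursion_invariant hτ0 hτ (hrec k) ih.1 ih.2.1 ih.2.2
  have hmono : StrictMono y := strictMono_nat_of_lt_succ fun n => (key n).2.2
  refine ⟨hmono, fun n hn => ?_⟩
  obtain ⟨s, hs⟩ : ∃ s, s = Real.sqrt τ := ⟨_, rfl⟩
  have hs0 : 0 < s := hs ▸ Real.sqrt_pos.2 hτ0
  have hsτ : s ^ 2 = τ := hs ▸ Real.sq_sqrt hτ0.le
  rw [← hs] at hn ⊢
  by_contra! hle
  have hlin : ∀ k ≤ n, τ + k * (τ / 4) ≤ y k := by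
    intro k
    induction k with
    | zero => simp [h0]
    | succ k ih =>
      intro hk
      have hinc := quarter_le_increment hs0 (hsτ ▸ hτ) (key k).1
        ((hmono.monotone (by omega : k ≤ n)).trans hle)
      rw [hsτ] at hinc
      have := ih (by omega)
      rw [hrec k]
      push_cast
      linarith
  have hn' : 1 ≤ n * (2 * s) := (div_le_iff₀ (by positivity)).1 hn
  have := hlin n le_rfl
  rw [← hsτ] at this
  nlinarith [mul_le_mul_of_nonneg_right hn' hs0.le, sq_nonneg s]
end

section
/- Let t ∈ (0,1), let N_n = 2^{n+1} − 1, and define β_n(t) = 1 if t < 1/n² and β_n(t) = 1 − √t/24 if t ≥ 1/n². Suppose (b_n)_{n≥0} is a sequence of nonnegative reals with b_n ≤ 1 for n = 0, 1, 2 and b_{n+1} ≤ (1/4)β_n(t) b_n + n²/4^{n+1} for all n ≥ 2. Then for every n ≥ 3, b_n < 800 (n/N_n)² / √t. -/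
/-- If `a (n+1) ≤ a n + n²` while `n s < 1` and `a (n+1) ≤ (1 - s/24) a n + n²` afterwards, then
`a n` grows at most like `n² / s`. -/
theorem mul_le_mul_sq_of_recursion (s : ℝ) (hs0 : 0 < s) (hs1 : s < 1) (a : ℕ → ℝ)
    (ha2 : a 2 ≤ 16)
    (hsmall : ∀ n : ℕ, 2 ≤ n → n * s < 1 → a (n + 1) ≤ a n + (n : ℝ) ^ 2)
    (hlarge : ∀ n : ℕ, 2 ≤ n → 1 ≤ n * s → a (n + 1) ≤ (1 - s / 24) * a n + (n : ℝ) ^ 2)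
    (n : ℕ) (hn : 2 ≤ n) : s * a n ≤ 200 * (n : ℝ) ^ 2 := by
  suffices h : s * a n ≤ 200 * (n : ℝ) ^ 2 ∧ (n * s < 1 → a n ≤ 2 * (n : ℝ) ^ 3) from h.1
  induction n, hn using Nat.le_induction with
  | base =>
    refine ⟨?_, fun _ => ?_⟩
    · norm_num
      nlinarith
    · norm_num
      exact ha2
  | succ n hn ih =>
    have hn' : (2 : ℝ) ≤ n := by exact_mod_cast hn
    obtain ⟨ih₁, ih₂⟩ := ih
    push_cast
    rcases lt_or_ge ((n : ℝ) * s) 1 with h | h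
    · have hcube := ih₂ h
      have hstep := hsmall n hn h
      refine ⟨?_, fun _ => by nlinarith⟩
      have h₁ : s * a (n + 1) ≤ s * (2 * (n : ℝ) ^ 3 + (n : ℝ) ^ 2) :=
        mul_le_mul_of_nonneg_left (by linarith) hs0.le
      have h₂ : (n * s) * (n : ℝ) ^ 2 ≤ 1 * (n : ℝ) ^ 2 :=
        mul_le_mul_of_nonneg_right h.le (sq_nonneg _)
      have h₃ : s * (n : ℝ) ^ 2 ≤ 1 * (n : ℝ) ^ 2 :=
        mul_le_mul_of_nonneg_right hs1.le (sq_nonneg _)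
      nlinarith
    · have hstep := hlarge n hn h
      refine ⟨?_, fun hlt => by nlinarith⟩
      have h₁ : s * a (n + 1) ≤ s * ((1 - s / 24) * a n + (n : ℝ) ^ 2) :=
        mul_le_mul_of_nonneg_left hstep hs0.le
      have h₂ : (1 - s / 24) * (s * a n) ≤ (1 - s / 24) * (200 * (n : ℝ) ^ 2) :=
        mul_le_mul_of_nonneg_left ih₁ (by linarith)
      have h₃ : 0 ≤ s * (n : ℝ) ^ 2 := by positivity
      nlinarith


/-- Let t ∈ (0,1), N_n = 2^{n+1} − 1, β_n(t) = 1 if t < 1/n² and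
1 − √t/24 otherwise.  If (b_n) is nonnegative with b_n ≤ 1 for n = 0,1,2 and
b_{n+1} ≤ (1/4)β_n(t)b_n + n²/4^{n+1} for all n ≥ 2, then for every n ≥ 3,
b_n < 800(n/N_n)²/√t. -/
theorem stmt_18 (t : ℝ) (ht0 : 0 < t) (ht1 : t < 1)
    (b : ℕ → ℝ) (hbnn : ∀ n, 0 ≤ b n)
    (hb012 : ∀ n, n ≤ 2 → b n ≤ 1)
    (hrec : ∀ n, 2 ≤ n →
      b (n+1) ≤ (1/4) * (if t < 1/(n : ℝ)^2 then 1 else 1 - Real.sqrt t / 24) * b n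
        + (n : ℝ)^2 / 4^(n+1)) :
    ∀ n, 3 ≤ n → b n < 800 * ((n : ℝ) / ((2 : ℝ)^(n+1) - 1))^2 / Real.sqrt t := by
  intro n hn
  have hs0 : 0 < √t := Real.sqrt_pos.2 ht0
  have hs1 : √t < 1 := (Real.sqrt_lt' one_pos).2 (by simpa using ht1)
  have hcond : ∀ k : ℕ, 2 ≤ k → (t < 1 / (k : ℝ) ^ 2 ↔ k * √t < 1) := by
    intro k hk
    have hk0 : (0 : ℝ) < k := by exact_mod_cast (by omega : 0 < k)
    rw [lt_div_iff₀ (by positivity), ← sq_lt_one_iff₀ (by positivity : (0 : ℝ) ≤ k * √t),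
      mul_pow, Real.sq_sqrt ht0.le, mul_comm]
  have hscale : ∀ (k : ℕ) (c : ℝ),
      b (k + 1) ≤ 1 / 4 * c * b k + (k : ℝ) ^ 2 / 4 ^ (k + 1) →
      4 ^ (k + 1) * b (k + 1) ≤ c * (4 ^ k * b k) + (k : ℝ) ^ 2 := by
    intro k c h
    calc (4 : ℝ) ^ (k + 1) * b (k + 1)
        ≤ 4 ^ (k + 1) * (1 / 4 * c * b k + (k : ℝ) ^ 2 / 4 ^ (k + 1)) := by gcongr
      _ = c * (4 ^ k * b k) + (k : ℝ) ^ 2 := by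
        field_simp
        ring
  have key := mul_le_mul_sq_of_recursion √t hs0 hs1 (fun k => 4 ^ k * b k)
    (by linarith [hb012 2 le_rfl])
    (fun k hk h => by
      have hr := hrec k hk
      rw [if_pos ((hcond k hk).2 h)] at hr
      simpa using hscale k 1 hr)
    (fun k hk h => by
      have hr := hrec k hk
      rw [if_neg (mt (hcond k hk).1 h.not_gt)] at hr
      exact hscale k _ hr)
    n (by omega)
  have hn0 : (0 : ℝ) < n := by exact_mod_cast (by omega : 0 < n)
  have hN0 : (0 : ℝ) < 2 ^ (n + 1) - 1 := sub_pos.2 (one_lt_pow₀ one_lt_two (by omega))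
  have hN : ((2 : ℝ) ^ (n + 1) - 1) ^ 2 < 4 * 4 ^ n := by
    have h4 : (4 : ℝ) * 4 ^ n = (2 ^ (n + 1)) ^ 2 := by
      rw [← pow_succ', ← pow_mul, mul_comm, pow_mul]
      norm_num
    rw [h4]
    exact pow_lt_pow_left₀ (by linarith) hN0.le two_ne_zero
  calc b n ≤ 800 * (n : ℝ) ^ 2 / (4 * 4 ^ n) / √t := by
        rw [div_div, le_div_iff₀ (by positivity)]
        linarith
    _ < 800 * (n : ℝ) ^ 2 / (2 ^ (n + 1) - 1) ^ 2 / √t := by gcongr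
    _ = 800 * ((n : ℝ) / ((2 : ℝ) ^ (n + 1) - 1)) ^ 2 / √t := by
        rw [div_pow, mul_div_assoc]
end

section
/- Let x ∈ (0,1) and let X, X' be independent, identically distributed nonnegative real random variables such that P(X > s) ≥ (1/2)(1 − 4√s) for every s ∈ (0,1). Then (1/2)(1 + x/2)·P(X > x)·P(X' > x) + (1/2)(1 − x/2)·P(X + X' > x) ≥ (1/2)(1 − 4√x). -/
open MeasureTheory

/-- A two-cell staircase bound for the distribution function of a sum of independent,
nonnegative random variables. -/
lemma measureReal_add_le_le_of_indepFun {Ω : Type*} [MeasurableSpace Ω] {μ : Measure Ω}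
    [IsProbabilityMeasure μ] {X Y : Ω → ℝ} (hX : Measurable X)
    (hindep : ProbabilityTheory.IndepFun X Y μ) (hX0 : ∀ ω, 0 ≤ X ω) (hY0 : ∀ ω, 0 ≤ Y ω)
    {a x : ℝ} (hax : a ≤ x) :
    μ.real {ω | X ω + Y ω ≤ x} ≤
      μ.real {ω | X ω ≤ a} * μ.real {ω | Y ω ≤ x} +
        (μ.real {ω | X ω ≤ x} - μ.real {ω | X ω ≤ a}) * μ.real {ω | Y ω ≤ x - a} := by
  have hsub : {ω | X ω + Y ω ≤ x} ⊆
      (X ⁻¹' Set.Iic a ∩ Y ⁻¹' Set.Iic x) ∪ (X ⁻¹' Set.Ioc a x ∩ Y ⁻¹' Set.Iic (x - a)) := by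
    intro ω hω
    have hω' : X ω + Y ω ≤ x := hω
    have := hX0 ω
    have := hY0 ω
    rcases le_or_gt (X ω) a with h | h
    · exact Or.inl ⟨h, show Y ω ≤ x by linarith⟩
    · exact Or.inr ⟨⟨h, by linarith⟩, show Y ω ≤ x - a by linarith⟩
  have hmul {s t : Set ℝ} (hs : MeasurableSet s) (ht : MeasurableSet t) :
      μ.real (X ⁻¹' s ∩ Y ⁻¹' t) = μ.real (X ⁻¹' s) * μ.real (Y ⁻¹' t) := by
    simp only [measureReal_def, hindep.measure_inter_preimage_eq_mul s t hs ht, ENNReal.toReal_mul]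
  have hdiff : μ.real (X ⁻¹' Set.Ioc a x) =
      μ.real (X ⁻¹' Set.Iic x) - μ.real (X ⁻¹' Set.Iic a) := by
    have h : Set.Ioc a x = Set.Iic x \ Set.Iic a := by
      ext
      simp [and_comm]
    rw [h, Set.preimage_sdiff,
      measureReal_sdiff (Set.preimage_mono (Set.Iic_subset_Iic.2 hax)) (hX measurableSet_Iic)]
  calc μ.real {ω | X ω + Y ω ≤ x}
      ≤ μ.real (X ⁻¹' Set.Iic a ∩ Y ⁻¹' Set.Iic x) +
          μ.real (X ⁻¹' Set.Ioc a x ∩ Y ⁻¹' Set.Iic (x - a)) :=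
        (measureReal_mono hsub).trans (measureReal_union_le _ _)
    _ = _ := by
        rw [hmul measurableSet_Iic measurableSet_Iic, hmul measurableSet_Ioc measurableSet_Iic,
          hdiff]
        rfl

lemma measureReal_lt_eq_one_sub {Ω : Type*} [MeasurableSpace Ω] {μ : Measure Ω}
    [IsProbabilityMeasure μ] {Y : Ω → ℝ} (hY : Measurable Y) (s : ℝ) :
    μ.real {ω | s < Y ω} = 1 - μ.real {ω | Y ω ≤ s} := by
  have h := probReal_compl_eq_one_sub (μ := μ) (hY (measurableSet_Iic (a := s)))
  rwa [← Set.preimage_compl, Set.compl_Iic] at h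

/-- The polynomial inequality behind the invariance of the tail bound `(1 - 4√x) / 2`: here
`A`, `B`, `C` are the values of the distribution function at `0.36 r ^ 2`, `0.64 r ^ 2`, `r ^ 2`. -/
lemma tail_bound_of_staircase {r A B C S : ℝ} (hr : 0 < r) (hr' : r < 1 / 4)
    (hA0 : 0 ≤ A) (hB0 : 0 ≤ B) (hA : A ≤ 1 / 2 + 6 / 5 * r) (hB : B ≤ 1 / 2 + 8 / 5 * r)
    (hC : C ≤ 1 / 2 + 2 * r) (hS : S ≤ A * C + (C - A) * B) :
    (1 / 2) * (1 - 4 * r) ≤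
      (1 / 2) * (1 + r ^ 2 / 2) * (1 - C) * (1 - C) + (1 / 2) * (1 - r ^ 2 / 2) * (1 - S) := by
  have hSr : S ≤ (1 / 2 + 6 / 5 * r) * (1 / 2 + 2 * r) + 4 / 5 * r * (1 / 2 + 8 / 5 * r) := by
    have h1 : (A + B) * C ≤ (A + B) * (1 / 2 + 2 * r) := by gcongr
    have h2 : A * (1 / 2 + 2 * r - B) ≤ (1 / 2 + 6 / 5 * r) * (1 / 2 + 2 * r - B) :=
      mul_le_mul_of_nonneg_right hA (by linarith)
    have h3 : 4 / 5 * r * B ≤ 4 / 5 * r * (1 / 2 + 8 / 5 * r) := by gcongr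
    linarith
  have hCr : (1 / 2 - 2 * r) * (1 / 2 - 2 * r) ≤ (1 - C) * (1 - C) :=
    mul_self_le_mul_self (by linarith) (by linarith)
  have h1 := mul_le_mul_of_nonneg_left hCr (show 0 ≤ 1 + r ^ 2 / 2 by positivity)
  have h2 := mul_le_mul_of_nonneg_left hSr (show 0 ≤ 1 - r ^ 2 / 2 by nlinarith)
  nlinarith [sq_nonneg r, sq_nonneg (r ^ 2)]

/-- Let x ∈ (0,1) and let X, X' be independent, identically distributed
nonnegative real random variables with P(X > s) ≥ (1/2)(1 − 4√s) for every s ∈ (0,1).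
Then (1/2)(1 + x/2)·P(X > x)·P(X' > x) + (1/2)(1 − x/2)·P(X + X' > x)
≥ (1/2)(1 − 4√x). -/
theorem stmt_19 {Ω : Type*} [MeasurableSpace Ω] (μ : Measure Ω) [IsProbabilityMeasure μ]
    (X X' : Ω → ℝ) (hX : Measurable X) (hX' : Measurable X')
    (hid : Measure.map X μ = Measure.map X' μ)
    (hindep : ProbabilityTheory.IndepFun X X' μ)
    (hnn : ∀ ω, 0 ≤ X ω) (hnn' : ∀ ω, 0 ≤ X' ω)
    (htail : ∀ s : ℝ, 0 < s → s < 1 →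
      (1/2) * (1 - 4 * Real.sqrt s) ≤ (μ {ω | s < X ω}).toReal)
    (x : ℝ) (hx0 : 0 < x) (hx1 : x < 1) :
    (1/2) * (1 - 4 * Real.sqrt x) ≤
      (1/2) * (1 + x/2) * (μ {ω | x < X ω}).toReal * (μ {ω | x < X' ω}).toReal +
      (1/2) * (1 - x/2) * (μ {ω | x < X ω + X' ω}).toReal := by
  simp only [← measureReal_def] at htail ⊢
  rcases le_or_gt (1 / 4) (Real.sqrt x) with hr | hr
  · have : 0 ≤ (1/2) * (1 + x/2) * μ.real {ω | x < X ω} * μ.real {ω | x < X' ω} +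
        (1/2) * (1 - x/2) * μ.real {ω | x < X ω + X' ω} := by
      have : 0 ≤ 1 - x / 2 := by linarith
      positivity
    linarith
  have hcdf (s : ℝ) : μ.real {ω | X' ω ≤ s} = μ.real {ω | X ω ≤ s} := by
    have h := congrArg (fun ν : Measure ℝ => ν.real (Set.Iic s)) hid
    rw [map_measureReal_apply hX measurableSet_Iic,
      map_measureReal_apply hX' measurableSet_Iic] at h
    exact h.symm
  have hle {c : ℝ} (hc0 : 0 < c) (hc1 : c ≤ 1) :
      μ.real {ω | X ω ≤ c ^ 2 * x} ≤ 1 / 2 + 2 * (c * Real.sqrt x) := by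
    have h := htail (c ^ 2 * x) (by positivity)
      (mul_lt_one_of_nonneg_of_lt_one_right (pow_le_one₀ hc0.le hc1) hx0.le hx1)
    rw [measureReal_lt_eq_one_sub hX, Real.sqrt_mul (sq_nonneg c), Real.sqrt_sq hc0.le] at h
    linarith
  have hA := hle (c := 3 / 5) (by norm_num) (by norm_num)
  have hB := hle (c := 4 / 5) (by norm_num) (by norm_num)
  have hC := hle (c := 1) (by norm_num) le_rfl
  have hS := measureReal_add_le_le_of_indepFun hX hindep hnn hnn'
    (show (3 / 5) ^ 2 * x ≤ x by linarith)
  rw [hcdf, hcdf, show x - (3 / 5) ^ 2 * x = (4 / 5) ^ 2 * x by ring] at hS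
  rw [one_pow, one_mul] at hC
  have h := tail_bound_of_staircase (Real.sqrt_pos.2 hx0) hr measureReal_nonneg
    measureReal_nonneg (by linarith) (by linarith) (by linarith) hS
  rw [Real.sq_sqrt hx0.le] at h
  rwa [measureReal_lt_eq_one_sub hX, measureReal_lt_eq_one_sub hX', hcdf,
    measureReal_lt_eq_one_sub (Y := fun ω => X ω + X' ω) (hX.add hX')]
end
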